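/- Define Λ(ξ) := ξ₃/‖ξ‖ for ξ ≠ 0, write ξ_h := (ξ₁,ξ₂,0), s(ξ) := √(1−Λ(ξ)²), and for ξ with ξ_h ≠ 0 let w(ξ) := (Λ(ξ)/s(ξ))·ξ_h − ‖ξ‖·s(ξ)·e₃. Let ξ, η ∈ ℝ³ with ξ_h ≠ 0 and (ξ−η)_h ≠ 0. Then w(ξ)·(∇Λ)(ξ−η) = −(‖ξ‖/‖ξ−η‖)·s(ξ−η)·[ Λ(ξ)·Λ(ξ−η)·(ξ_h·(ξ_h−η_h))/(‖ξ_h‖·‖ξ_h−η_h‖) + s(ξ)·s(ξ−η) ]. -/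

import Mathlib

open MeasureTheory RealInnerProductSpace

noncomputable section

/-- Euclidean 3-space. -/
abbrev E3 : Type := EuclideanSpace ℝ (Fin 3)

/-- The vector `(a, b, c) ∈ ℝ³`. -/
def Ev3 (a b c : ℝ) : E3 := (WithLp.equiv 2 (Fin 3 → ℝ)).symm ![a, b, c]

/-- Horizontal part `v_h = (v₁, v₂, 0)` of a vector `v ∈ ℝ³`. -/
def hpart (v : E3) : E3 := Ev3 (v 0) (v 1) 0

/-- Horizontal rotation by 90 degrees: `v_h^⊥ = (−v₂, v₁, 0)`. -/
def hperp (v : E3) : E3 := Ev3 (-(v 1)) (v 0) 0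

/-- The quantity `σ̄(ξ,η) := ξ₃ η_h − η₃ ξ_h`. -/
def sigmaBar (ξ η : E3) : E3 := (ξ 2) • hpart η - (η 2) • hpart ξ

/-- The dispersion relation `Λ(ξ) = ξ₃ / ‖ξ‖`. -/
def Lam (ξ : E3) : ℝ := ξ 2 / ‖ξ‖

/-- `s(ξ) := √(1 − Λ(ξ)²)`. -/
def sfun (ξ : E3) : ℝ := Real.sqrt (1 - Lam ξ ^ 2)

/-- The vertical unit vector `e₃`. -/
def e₃ : E3 := Ev3 0 0 1

/-- The direction `w(ξ) = (Λ(ξ)/s(ξ)) ξ_h − ‖ξ‖ s(ξ) e₃` of the vector field `Υ = ∂_φ`. -/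
def wvec (ξ : E3) : E3 := (Lam ξ / sfun ξ) • hpart ξ - (‖ξ‖ * sfun ξ) • e₃

theorem norm_sq_eq_norm_hpart_sq_add (v : E3) : ‖v‖ ^ 2 = ‖hpart v‖ ^ 2 + v 2 ^ 2 := by
  simp [EuclideanSpace.norm_sq_eq, Fin.sum_univ_three, hpart, Ev3]

theorem ne_zero_of_hpart_ne_zero {v : E3} (hv : hpart v ≠ 0) : v ≠ 0 := by
  rintro rfl
  apply hv
  ext i
  fin_cases i <;> simp [hpart, Ev3]

theorem hpart_sub (v w : E3) : hpart (v - w) = hpart v - hpart w := by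
  ext i
  fin_cases i <;> simp [hpart, Ev3]

theorem sfun_eq_norm_hpart_div_norm {v : E3} (hv : v ≠ 0) : sfun v = ‖hpart v‖ / ‖v‖ := by
  have hn : ‖v‖ ≠ 0 := norm_ne_zero_iff.mpr hv
  have h : 1 - Lam v ^ 2 = (‖hpart v‖ / ‖v‖) ^ 2 := by
    rw [Lam]
    field_simp
    linarith [norm_sq_eq_norm_hpart_sq_add v]
  rw [sfun, h, Real.sqrt_sq (by positivity)]

theorem differentiableAt_Lam {v : E3} (hv : v ≠ 0) : DifferentiableAt ℝ Lam v := by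
  have hn : ‖v‖ ≠ 0 := norm_ne_zero_iff.mpr hv
  have h : DifferentiableAt ℝ (fun x : E3 => ‖x‖) v := differentiableAt_id.norm ℝ hv
  have h2 : DifferentiableAt ℝ (fun x : E3 => x 2) v := by fun_prop
  have hL : Lam = fun x : E3 => x 2 * ‖x‖⁻¹ := funext fun x => div_eq_mul_inv _ _
  rw [hL]
  exact h2.mul (h.inv hn)

theorem fderiv_Lam_apply {v : E3} (hv : v ≠ 0) (w : E3) :
    fderiv ℝ Lam v w = w 2 / ‖v‖ - v 2 * ⟪v, w⟫ / ‖v‖ ^ 3 := by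
  have hn : ‖v‖ ≠ 0 := norm_ne_zero_iff.mpr hv
  have hL := (differentiableAt_Lam hv).hasFDerivAt
  have hline : HasDerivAt (fun t : ℝ => v + t • w) w 0 := by
    simpa using ((hasDerivAt_id (0 : ℝ)).smul_const w).const_add v
  have hv0 : v + (0 : ℝ) • w = v := by simp
  have hnum : HasDerivAt (fun t : ℝ => (v + t • w) 2) (w 2) 0 := by
    simpa using ((hasDerivAt_id (0 : ℝ)).mul_const (w 2)).const_add (v 2)
  have hnorm : HasDerivAt (fun t : ℝ => ‖v + t • w‖) (⟪v, w⟫ / ‖v‖) 0 := by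
    have h := hline.norm_sq.sqrt (by simpa using hv)
    simp only [Real.sqrt_sq (norm_nonneg _), hv0] at h
    convert h using 1
    field_simp
  have hq := hnum.div hnorm (by simpa using hv)
  have hc : HasDerivAt (fun t : ℝ => Lam (v + t • w)) (fderiv ℝ Lam v w) 0 :=
    HasFDerivAt.comp_hasDerivAt (l := Lam) (f := fun t : ℝ => v + t • w) 0 (by rwa [hv0]) hline
  rw [hc.unique hq, hv0]
  field_simp

theorem inner_eq_inner_hpart_add (v w : E3) : ⟪v, w⟫ = ⟪hpart w, hpart v⟫ + v 2 * w 2 := by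
  simp [PiLp.inner_apply, Fin.sum_univ_three, hpart, Ev3]
  ring

theorem wvec_two (v : E3) : wvec v 2 = -(‖v‖ * sfun v) := by
  simp [wvec, hpart, e₃, Ev3]

theorem hpart_wvec (v : E3) : hpart (wvec v) = (Lam v / sfun v) • hpart v := by
  ext i
  fin_cases i <;> simp [wvec, hpart, e₃, Ev3]

/-- **Explicit formula for `Υ_ξΛ(ξ−η)` (equation (6.14)).**
For `ξ_h ≠ 0` and `(ξ−η)_h ≠ 0`,
`w(ξ)·(∇Λ)(ξ−η) = −(‖ξ‖/‖ξ−η‖) s(ξ−η) [Λ(ξ)Λ(ξ−η) (ξ_h·(ξ_h−η_h))/(‖ξ_h‖‖ξ_h−η_h‖)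
  + s(ξ)s(ξ−η)]`. -/
theorem stmt_13 (ξ η : E3) (hξ : hpart ξ ≠ 0) (hζ : hpart (ξ - η) ≠ 0) :
    DifferentiableAt ℝ Lam (ξ - η) ∧
    fderiv ℝ Lam (ξ - η) (wvec ξ)
      = -(‖ξ‖ / ‖ξ - η‖) * sfun (ξ - η)
          * (Lam ξ * Lam (ξ - η)
              * (⟪hpart ξ, hpart ξ - hpart η⟫ / (‖hpart ξ‖ * ‖hpart ξ - hpart η‖))
            + sfun ξ * sfun (ξ - η)) := by
  have hξ0 := ne_zero_of_hpart_ne_zero hξ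
  have hζ0 := ne_zero_of_hpart_ne_zero hζ
  refine ⟨differentiableAt_Lam hζ0, ?_⟩
  rw [← hpart_sub]
  generalize ξ - η = ζ at *
  have h1 : ‖ξ‖ ≠ 0 := norm_ne_zero_iff.mpr hξ0
  have h2 : ‖ζ‖ ≠ 0 := norm_ne_zero_iff.mpr hζ0
  have h3 : ‖hpart ξ‖ ≠ 0 := norm_ne_zero_iff.mpr hξ
  have h4 : ‖hpart ζ‖ ≠ 0 := norm_ne_zero_iff.mpr hζ
  rw [fderiv_Lam_apply hζ0, inner_eq_inner_hpart_add, hpart_wvec, wvec_two, real_inner_smul_left,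
    sfun_eq_norm_hpart_div_norm hξ0, sfun_eq_norm_hpart_div_norm hζ0, Lam, Lam]
  field_simp
  rw [norm_sq_eq_norm_hpart_sq_add ζ]
  ring
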